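/- arXiv:2109.09398 — 2 statements merged into one kernel-verified Lean document; each statement's English description precedes it below -/
import Mathlib

section
/- (Ramanujan's identity) For complex numbers z₁, z₂, s with Re(s) > max(1, 1+Re(z₁), 1+Re(z₂), 1+Re(z₁+z₂)), one has ∑_{n=1}^{∞} σ_{z₁}(n)σ_{z₂}(n)/n^s = ζ(s)ζ(s−z₁)ζ(s−z₂)ζ(s−z₁−z₂)/ζ(2s−z₁−z₂). -/
open Complex

/-- `σ_z(n) = ∑_{d | n} d^z`. -/
noncomputable def sigmaz (z : ℂ) (n : ℕ) : ℂ :=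
  ∑ d ∈ n.divisors, (d : ℂ) ^ z

lemma hasSum_congr_aux {ι : Type*} {f g : ι → ℂ} {a : ℂ} (h : ∀ i, f i = g i) :
    HasSum f a ↔ HasSum g a := by
  rw [funext h]

/-- The set of coprime pairs of positive integers. -/
abbrev CopPair : Type := {p : ℕ+ × ℕ+ // Nat.Coprime (p.1 : ℕ) (p.2 : ℕ)}

lemma hasSum_zeta_pnat {w : ℂ} (hw : 1 < w.re) :
    HasSum (fun n : ℕ+ => ((n : ℕ) : ℂ) ^ (-w)) (riemannZeta w) := by
  have hw0 : w ≠ 0 := by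
    rintro rfl
    simp at hw
    linarith
  have h1 : HasSum (fun n : ℕ => 1 / (n : ℂ) ^ w) (riemannZeta w) := by
    rw [zeta_eq_tsum_one_div_nat_cpow hw]
    exact (Complex.summable_one_div_nat_cpow.mpr hw).hasSum
  have h2 : HasSum ((fun n : ℕ => 1 / (n : ℂ) ^ w) ∘ (fun n : ℕ+ => (n : ℕ)))
      (riemannZeta w) := by
    rw [Function.Injective.hasSum_iff PNat.coe_injective]
    · exact h1
    · intro x hx
      have : x = 0 := by
        by_contra h
        exact hx ⟨⟨x, Nat.pos_of_ne_zero h⟩, rfl⟩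
      subst this
      simp [Complex.zero_cpow hw0]
  refine (hasSum_congr_aux ?_).mp h2
  intro n
  simp [Complex.cpow_neg]

lemma hasSum_mul_aux {ι κ : Type*} {f : ι → ℂ} {g : κ → ℂ} {a b : ℂ} (hf : HasSum f a)
    (hg : HasSum g b) : HasSum (fun t : ι × κ => f t.1 * g t.2) (a * b) :=
  hf.mul hg (summable_mul_of_summable_norm hf.summable.norm hg.summable.norm)

lemma natCast_mul_cpow' (a b : ℕ) (w : ℂ) :
    ((a : ℂ) * (b : ℂ)) ^ w = (a : ℂ) ^ w * (b : ℂ) ^ w :=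
  Complex.natCast_mul_natCast_cpow a b w

lemma cop_split (d e : ℕ+) : ∃ g x y : ℕ+, Nat.Coprime (x : ℕ) (y : ℕ) ∧ d = g * x ∧ e = g * y := by
  obtain ⟨g, x, y, hg, hc, hx, hy⟩ := Nat.exists_coprime' (m := (d : ℕ)) (n := (e : ℕ))
    (Nat.gcd_pos_of_pos_left _ d.pos)
  have hx0 : 0 < x := Nat.pos_of_ne_zero (by rintro rfl; have := d.pos; simp at hx)
  have hy0 : 0 < y := Nat.pos_of_ne_zero (by rintro rfl; have := e.pos; simp at hy)
  refine ⟨⟨g, hg⟩, ⟨x, hx0⟩, ⟨y, hy0⟩, hc, ?_, ?_⟩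
  · apply PNat.coe_injective; exact hx.trans (mul_comm _ _)
  · apply PNat.coe_injective; exact hy.trans (mul_comm _ _)

lemma cop_inj {g x y g' x' y' : ℕ+} (h : Nat.Coprime (x : ℕ) (y : ℕ))
    (h' : Nat.Coprime (x' : ℕ) (y' : ℕ)) (h1 : g * x = g' * x') (h2 : g * y = g' * y') :
    g = g' ∧ x = x' ∧ y = y' := by
  have e1 : (g : ℕ) * x = g' * x' := by exact_mod_cast congrArg PNat.val h1
  have e2 : (g : ℕ) * y = g' * y' := by exact_mod_cast congrArg PNat.val h2
  have hg : (g : ℕ) = g' := by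
    have a1 : Nat.gcd ((g : ℕ) * x) (g * y) = g := by rw [Nat.gcd_mul_left, h.gcd_eq_one, mul_one]
    have a2 : Nat.gcd ((g' : ℕ) * x') (g' * y') = g' := by
      rw [Nat.gcd_mul_left, h'.gcd_eq_one, mul_one]
    rw [← a1, ← a2, e1, e2]
  have hg' : g = g' := PNat.coe_injective hg
  subst hg'
  exact ⟨rfl, mul_left_cancel h1, mul_left_cancel h2⟩

lemma cpow_id4 (z₁ z₂ s : ℂ) (k g x y : ℕ+) :
    (((g * x : ℕ+) : ℕ) : ℂ) ^ z₁ * (((g * y : ℕ+) : ℕ) : ℂ) ^ z₂ /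
      (((k * g * x * y : ℕ+) : ℕ) : ℂ) ^ s =
    ((k : ℕ) : ℂ) ^ (-s) * (((g : ℕ) : ℂ) ^ (-(s - z₁ - z₂)) *
      (((x : ℕ) : ℂ) ^ (-(s - z₁)) * ((y : ℕ) : ℂ) ^ (-(s - z₂)))) := by
  have n0 : ∀ a : ℕ+, ((a : ℕ) : ℂ) ≠ 0 := fun a => by exact_mod_cast a.ne_zero
  have m : ∀ (a b : ℕ+) (w : ℂ), (((a * b : ℕ+) : ℕ) : ℂ) ^ w =
      ((a : ℕ) : ℂ) ^ w * ((b : ℕ) : ℂ) ^ w := fun a b w => by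
    rw [PNat.mul_coe, Nat.cast_mul, natCast_mul_cpow']
  have hne : ∀ (a : ℕ+) (w : ℂ), ((a : ℕ) : ℂ) ^ w ≠ 0 := fun a w => by
    simp [Complex.cpow_eq_zero_iff]
  simp only [m, neg_sub, Complex.cpow_neg, Complex.cpow_sub _ _ (n0 _)]
  have := hne g z₁
  have := hne k s
  have := hne g s
  have := hne x s
  have := hne y s
  field_simp

/-- The summand over triples `(n, d, e)` with `d, e ∣ n`. -/
noncomputable def tripleTerm (z₁ z₂ s : ℂ) (t : ℕ × (ℕ × ℕ)) : ℂ :=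
    if t.2 ∈ t.1.divisors ×ˢ t.1.divisors then
      (t.2.1 : ℂ) ^ z₁ * (t.2.2 : ℂ) ^ z₂ / (t.1 : ℂ) ^ s else 0

/-- The parametrization of triples. -/
def tripleMap (t : ℕ+ × (ℕ+ × CopPair)) : ℕ × (ℕ × ℕ) :=
    (((t.1 * t.2.1 * t.2.2.1.1 * t.2.2.1.2 : ℕ+) : ℕ),
      (((t.2.1 * t.2.2.1.1 : ℕ+) : ℕ), ((t.2.1 * t.2.2.1.2 : ℕ+) : ℕ)))

lemma tripleMap_inj : Function.Injective tripleMap := by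
  rintro ⟨k, g, ⟨⟨x, y⟩, h⟩⟩ ⟨k', g', ⟨⟨x', y'⟩, h'⟩⟩ he
  simp only [tripleMap, Prod.mk.injEq, PNat.coe_inj] at he
  obtain ⟨rfl, rfl, rfl⟩ := cop_inj h h' he.2.1 he.2.2
  have hk : k = k' := by
    have := he.1
    simpa only [mul_left_inj] using this
  subst hk
  rfl

lemma hasSum_triple (z₁ z₂ s S : ℂ) (hADP : HasSum (fun t : ℕ+ × (ℕ+ × CopPair) =>
      ((t.1 : ℕ) : ℂ) ^ (-s) * (((t.2.1 : ℕ) : ℂ) ^ (-(s - z₁ - z₂)) *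
      (((t.2.2.1.1 : ℕ) : ℂ) ^ (-(s - z₁)) * ((t.2.2.1.2 : ℕ) : ℂ) ^ (-(s - z₂))))) S) :
    HasSum (tripleTerm z₁ z₂ s) S := by
  rw [← tripleMap_inj.hasSum_iff]
  · refine (hasSum_congr_aux ?_).mpr hADP
    rintro ⟨k, g, ⟨⟨x, y⟩, h⟩⟩
    have hmem : (tripleMap (k, g, ⟨(x, y), h⟩)).2 ∈ (tripleMap (k, g, ⟨(x, y), h⟩)).1.divisors ×ˢ
        (tripleMap (k, g, ⟨(x, y), h⟩)).1.divisors := by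
      simp only [tripleMap, Finset.mem_product, Nat.mem_divisors]
      refine ⟨⟨⟨k * y, ?_⟩, PNat.ne_zero _⟩, ⟨⟨k * x, ?_⟩, PNat.ne_zero _⟩⟩ <;>
        · push_cast; ring
    simp only [Function.comp, tripleTerm]
    rw [if_pos hmem]
    exact cpow_id4 z₁ z₂ s k g x y
  · rintro ⟨n, d, e⟩ hr
    simp only [tripleTerm]
    rw [if_neg]
    intro hm
    apply hr
    simp only [Finset.mem_product, Nat.mem_divisors] at hm
    obtain ⟨⟨hd, hn⟩, he, -⟩ := hm
    have hd0 : 0 < d := Nat.pos_of_dvd_of_pos hd (Nat.pos_of_ne_zero hn)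
    have he0 : 0 < e := Nat.pos_of_dvd_of_pos he (Nat.pos_of_ne_zero hn)
    obtain ⟨g, x, y, hc, hdx, hey⟩ := cop_split ⟨d, hd0⟩ ⟨e, he0⟩
    have hdx' : d = g * x := by simpa using congrArg PNat.val hdx
    have hey' : e = g * y := by simpa using congrArg PNat.val hey
    subst hdx' hey'
    have hl : (g : ℕ) * (x * y) ∣ n := by
      have := Nat.lcm_dvd hd he
      rwa [Nat.lcm_mul_left, hc.lcm_eq_mul] at this
    obtain ⟨k, rfl⟩ := hl
    have hk : 0 < k := Nat.pos_of_ne_zero (by rintro rfl; simp at hn)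
    obtain ⟨k, rfl⟩ : ∃ k' : ℕ+, (k' : ℕ) = k := ⟨⟨k, hk⟩, rfl⟩
    refine ⟨(k, g, ⟨(x, y), hc⟩), ?_⟩
    simp only [tripleMap, PNat.mul_coe, Prod.mk.injEq, and_true]
    ring

lemma coprime_sum (z₁ z₂ s S T : ℂ)
    (hEP : HasSum (fun t : ℕ+ × CopPair => ((t.1 : ℕ) : ℂ) ^ (-(2 * s - z₁ - z₂)) *
      (((t.2.1.1 : ℕ) : ℂ) ^ (-(s - z₁)) * ((t.2.1.2 : ℕ) : ℂ) ^ (-(s - z₂)))) S)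
    (hBC : HasSum (fun t : ℕ+ × ℕ+ =>
      ((t.1 : ℕ) : ℂ) ^ (-(s - z₁)) * ((t.2 : ℕ) : ℂ) ^ (-(s - z₂))) T) : S = T := by
  refine hEP.unique ?_
  have hinj : Function.Injective (fun t : ℕ+ × CopPair => (t.1 * t.2.1.1, t.1 * t.2.1.2)) := by
    rintro ⟨g, ⟨⟨x, y⟩, h⟩⟩ ⟨g', ⟨⟨x', y'⟩, h'⟩⟩ he
    simp only [Prod.mk.injEq] at he
    obtain ⟨rfl, rfl, rfl⟩ := cop_inj h h' he.1 he.2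
    rfl
  refine (hasSum_congr_aux ?_).mp ((hinj.hasSum_iff ?_).mpr hBC)
  rotate_left
  · rintro ⟨d, e⟩ hde
    obtain ⟨g, x, y, hc, rfl, rfl⟩ := cop_split d e
    exact absurd ⟨(g, ⟨(x, y), hc⟩), rfl⟩ hde
  · rintro ⟨g, ⟨⟨x, y⟩, h⟩⟩
    have n0 : ((g : ℕ) : ℂ) ≠ 0 := by exact_mod_cast g.ne_zero
    simp only [Function.comp, PNat.mul_coe, Nat.cast_mul, natCast_mul_cpow']
    rw [show -(2 * s - z₁ - z₂) = -(s - z₁) + -(s - z₂) by ring, Complex.cpow_add _ _ n0]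
    ring

lemma sigma_fiber (z₁ z₂ s : ℂ) (n : ℕ) : HasSum (fun p : ℕ × ℕ => tripleTerm z₁ z₂ s (n, p))
    (sigmaz z₁ n * sigmaz z₂ n / (n : ℂ) ^ s) := by
  have : sigmaz z₁ n * sigmaz z₂ n / (n : ℂ) ^ s =
      ∑ p ∈ n.divisors ×ˢ n.divisors, tripleTerm z₁ z₂ s (n, p) := by
    rw [sigmaz, sigmaz, Finset.sum_mul_sum, ← Finset.sum_product', Finset.sum_div]
    refine Finset.sum_congr rfl fun p hp => ?_
    simp only [tripleTerm]
    rw [if_pos hp]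
  rw [this]
  refine hasSum_sum_of_ne_finset_zero fun p hp => ?_
  simp only [tripleTerm]
  rw [if_neg hp]

/-- Ramanujan's identity: for `Re(s)` large enough,
`∑ σ_{z₁}(n)σ_{z₂}(n)/n^s = ζ(s)ζ(s−z₁)ζ(s−z₂)ζ(s−z₁−z₂)/ζ(2s−z₁−z₂)`. -/
theorem ramanujan_identity (z₁ z₂ s : ℂ)
    (hs : max (max 1 (1 + z₁.re)) (max (1 + z₂.re) (1 + (z₁ + z₂).re)) < s.re) :
    ∑' n : ℕ, sigmaz z₁ n * sigmaz z₂ n / (n : ℂ) ^ s =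
      riemannZeta s * riemannZeta (s - z₁) * riemannZeta (s - z₂) *
        riemannZeta (s - z₁ - z₂) / riemannZeta (2 * s - z₁ - z₂) := by
  simp only [max_lt_iff, add_re] at hs
  obtain ⟨⟨h1, h2⟩, h3, h4⟩ := hs
  have hA := hasSum_zeta_pnat (w := s) h1
  have hB := hasSum_zeta_pnat (w := s - z₁) (by simp; linarith)
  have hC := hasSum_zeta_pnat (w := s - z₂) (by simp; linarith)
  have hD := hasSum_zeta_pnat (w := s - z₁ - z₂) (by simp; linarith)
  have hEre : 1 < (2 * s - z₁ - z₂).re := by simp; linarith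
  have hE := hasSum_zeta_pnat (w := 2 * s - z₁ - z₂) hEre
  have hE0 : riemannZeta (2 * s - z₁ - z₂) ≠ 0 := riemannZeta_ne_zero_of_one_lt_re hEre
  have hBC := hasSum_mul_aux hB hC
  obtain ⟨P, hP⟩ := (hBC.summable.comp_injective
    (Subtype.val_injective (p := fun p : ℕ+ × ℕ+ => Nat.Coprime (p.1 : ℕ) (p.2 : ℕ))))
  -- the coprime sum
  have hEP := hasSum_mul_aux hE hP
  have key1 := coprime_sum z₁ z₂ s _ _ hEP hBC
  -- the full sum
  have hADP := hasSum_mul_aux hA (hasSum_mul_aux hD hP)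
  have hG := hasSum_triple z₁ z₂ s _ hADP
  have hfin := hG.prod_fiberwise (sigma_fiber z₁ z₂ s)
  rw [hfin.tsum_eq, eq_div_iff hE0]
  linear_combination (riemannZeta s * riemannZeta (s - z₁ - z₂)) * key1
end

section
/- Let K be a number field. For complex z₁, z₂, s with Re(s) > max(1, 1+Re(z₁), 1+Re(z₂), 1+Re(z₁+z₂)), one has ∑_{I ⊆ O_K, I ≠ 0} σ_{K,z₁}(I)σ_{K,z₂}(I)/N(I)^s = ζ_K(s)ζ_K(s−z₁)ζ_K(s−z₂)ζ_K(s−z₁−z₂)/ζ_K(2s−z₁−z₂). -/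
open scoped Classical

open NumberField

variable (K : Type*) [Field K] [NumberField K]

/-- The Möbius function on nonzero ideals of `𝓞 K`: `(−1)^r` on a product of `r`
distinct prime ideals, `0` if not squarefree. -/
noncomputable def idealMu (I : Ideal (𝓞 K)) : ℤ :=
  if Squarefree I then (-1) ^ Multiset.card (UniqueFactorizationMonoid.factors I) else 0

/-- `σ_{K,z}(I) = ∑_{I₁ | I} N(I₁)^z`. -/
noncomputable def sigmaK (z : ℂ) (I : Ideal (𝓞 K)) : ℂ :=
  ∑' I₁ : Ideal (𝓞 K), if I₁ ∣ I then (Ideal.absNorm I₁ : ℂ) ^ z else 0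

/-- The Dedekind zeta function `ζ_K(s) = ∑_{I ≠ 0} N(I)^{−s}`. -/
noncomputable def zetaK (s : ℂ) : ℂ :=
  ∑' I : {I : Ideal (𝓞 K) // I ≠ ⊥}, (Ideal.absNorm I.1 : ℂ) ^ (-s)

/-- The Ramanujan sum over `K`: `C_J(I) = ∑_{I₁ | J, I₁ | I} N(I₁)·μ(J/I₁)`,
written as a sum over factorizations `J = I₁·I₂`. -/
noncomputable def ramanujanCK (J I : Ideal (𝓞 K)) : ℂ :=
  ∑' p : Ideal (𝓞 K) × Ideal (𝓞 K),
    if p.1 * p.2 = J ∧ p.1 ∣ I then (Ideal.absNorm p.1 : ℂ) * (idealMu K p.2 : ℂ) else 0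

section helpers

open Filter Topology

/-- The type of nonzero ideals. -/
abbrev NzI : Type _ := {I : Ideal (𝓞 K) // I ≠ ⊥}

/-- Coprime pairs of nonzero ideals. -/
abbrev CopI : Type _ := {p : NzI K × NzI K // p.1.1 ⊔ p.2.1 = ⊤}

variable {K} in
/-- Product of nonzero ideals. -/
def NzI.mul (I J : NzI K) : NzI K := ⟨I.1 * J.1, mul_ne_zero I.2 J.2⟩

/-- The norm power. -/
noncomputable def nrm (I : NzI K) (z : ℂ) : ℂ := (Ideal.absNorm I.1 : ℂ) ^ z

lemma NzI.norm_pos (I : NzI K) : 0 < Ideal.absNorm I.1 :=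
  Nat.pos_of_ne_zero (fun h => I.2 (Ideal.absNorm_eq_zero_iff.mp h))

lemma nrm_mul (I J : NzI K) (z : ℂ) : nrm K (I.mul J) z = nrm K I z * nrm K J z := by
  simp only [nrm, NzI.mul, map_mul, Nat.cast_mul]
  exact Complex.natCast_mul_natCast_cpow _ _ _

lemma nrm_add (I : NzI K) (z w : ℂ) : nrm K I (z + w) = nrm K I z * nrm K I w :=
  Complex.cpow_add _ _ (by exact_mod_cast (I.norm_pos K).ne')

lemma nrm_neg (I : NzI K) (z : ℂ) : nrm K I (-z) = (nrm K I z)⁻¹ := Complex.cpow_neg _ _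

lemma nrm_ne_zero (I : NzI K) (z : ℂ) : nrm K I z ≠ 0 := by
  have : (Ideal.absNorm I.1 : ℂ) ≠ 0 := by exact_mod_cast (I.norm_pos K).ne'
  simp [nrm, Complex.cpow_eq_zero_iff, this]

lemma norm_nrm (I : NzI K) (z : ℂ) : ‖nrm K I z‖ = (Ideal.absNorm I.1 : ℝ) ^ z.re :=
  Complex.norm_natCast_cpow_of_pos (I.norm_pos K) _

lemma lseries_summable_card (s : ℂ) (hs : 1 < s.re) :
    LSeriesSummable (fun n ↦ ((Nat.card {I : Ideal (𝓞 K) // Ideal.absNorm I = n} : ℝ) : ℂ)) s := by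
  refine LSeriesSummable_of_sum_norm_bigO_and_nonneg (r := 1)
    (f := fun n ↦ (Nat.card {I : Ideal (𝓞 K) // Ideal.absNorm I = n} : ℝ)) ?_
    (fun _ ↦ Nat.cast_nonneg _) zero_le_one hs
  have h := ((NumberField.Ideal.tendsto_norm_le_div_atTop₀ K).comp
    (tendsto_natCast_atTop_atTop (R := ℝ)))
  simp only [Real.rpow_one]
  refine Asymptotics.isBigO_of_div_tendsto_nhds ?_ _ (h.congr fun n ↦ ?_)
  · filter_upwards [eventually_gt_atTop 0] with n hn h0
    exact absurd h0 (by exact_mod_cast hn.ne')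
  simp only [Function.comp_apply, Nat.cast_le, ← Nat.cast_sum, Pi.div_apply]
  congr 2
  rw [← add_left_inj 1, ← Ideal.card_norm_le_eq_card_norm_le_add_one,
    show Finset.Icc 1 n = Finset.Ioc 0 n from Finset.Icc_succ_left_eq_Ioc _ _,
    show 1 = Nat.card {I : Ideal (𝓞 K) // Ideal.absNorm I = 0} by
      simp [Ideal.absNorm_eq_zero_iff],
    Finset.sum_Ioc_add_eq_sum_Icc (n.zero_le),
    ← Finset.card_preimage_eq_sum_card_image_eq (fun k _ ↦ Ideal.finite_setOfPred_absNorm_eq k)]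
  simp [Set.coe_eq_subtype]

lemma summable_absNorm (x : ℝ) (hx : 1 < x) :
    Summable (fun I : Ideal (𝓞 K) ↦ (Ideal.absNorm I : ℝ) ^ (-x)) := by
  have h := (lseries_summable_card K (x : ℂ) (by simpa using hx)).norm
  refine (summable_partition (s := fun n : ℕ ↦ {I : Ideal (𝓞 K) | Ideal.absNorm I = n})
    (fun I ↦ by positivity) (fun I ↦ ⟨_, rfl, fun _ h ↦ h.symm⟩)).2 ⟨fun n ↦ ?_, ?_⟩
  · have := (Ideal.finite_setOfPred_absNorm_eq (S := 𝓞 K) n).to_subtype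
    exact Summable.of_finite
  · refine h.congr fun n ↦ ?_
    have hfin := (Ideal.finite_setOfPred_absNorm_eq (S := 𝓞 K) n).to_subtype
    have := Fintype.ofFinite ({I : Ideal (𝓞 K) | Ideal.absNorm I = n})
    have e : ∀ I : {I : Ideal (𝓞 K) | Ideal.absNorm I = n},
      (Ideal.absNorm I.1 : ℝ) ^ (-x) = (n : ℝ) ^ (-x) := fun I ↦ by
        rw [show Ideal.absNorm I.1 = n from I.2]
    rw [tsum_congr e, tsum_fintype, Finset.sum_const, LSeries.norm_term_eq, nsmul_eq_mul,
      Finset.card_univ, ← Nat.card_eq_fintype_card]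
    split_ifs with h0
    · subst h0
      simp [Real.zero_rpow (show -x ≠ 0 by linarith)]
    · rw [Real.rpow_neg (by positivity), div_eq_mul_inv]
      simp
      exact Or.inl rfl

lemma summable_norm_nrm (s : ℂ) (hs : 1 < s.re) : Summable (fun I : NzI K ↦ ‖nrm K I (-s)‖) := by
  simp only [norm_nrm, Complex.neg_re]
  exact (summable_absNorm K s.re hs).subtype _

/-- The common divisor parametrization. -/
noncomputable def mapA (t : NzI K × CopI K) : NzI K × NzI K :=
  (t.1.mul t.2.1.1, t.1.mul t.2.1.2)

lemma exists_gcd (A B : NzI K) : ∃ t, mapA K t = (A, B) := by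
  obtain ⟨A, hA⟩ := A
  obtain ⟨B, hB⟩ := B
  obtain ⟨q, hq⟩ : A ⊔ B ∣ A := Ideal.dvd_iff_le.2 le_sup_left
  obtain ⟨r, hr⟩ : A ⊔ B ∣ B := Ideal.dvd_iff_le.2 le_sup_right
  have hS : A ⊔ B ≠ ⊥ := fun h ↦ hA (by rw [h] at hq; simpa using hq)
  have hq0 : q ≠ ⊥ := fun h ↦ hA (by rw [h] at hq; simpa using hq)
  have hr0 : r ≠ ⊥ := fun h ↦ hB (by rw [h] at hr; simpa using hr)
  have hc : q ⊔ r = ⊤ := by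
    have : (A ⊔ B) * (q ⊔ r) = (A ⊔ B) * ⊤ := by
      rw [Ideal.mul_sup, ← hq, ← hr, Ideal.mul_top]
    exact mul_left_cancel₀ hS this
  exact ⟨(⟨A ⊔ B, hS⟩, ⟨(⟨q, hq0⟩, ⟨r, hr0⟩), hc⟩),
    Prod.ext (Subtype.ext hq.symm) (Subtype.ext hr.symm)⟩

lemma NzI.mul_cancel {A B C : NzI K} (h : A.mul B = A.mul C) : B = C :=
  Subtype.ext (mul_left_cancel₀ A.2 (congrArg Subtype.val h))

lemma mapA_inj : Function.Injective (mapA K) := by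
  have key : ∀ t, (mapA K t).1.1 ⊔ (mapA K t).2.1 = t.1.1 := fun t ↦ by
    simp only [mapA, NzI.mul]
    rw [← Ideal.mul_sup, t.2.2, Ideal.mul_top]
  rintro ⟨S, ⟨⟨q, r⟩, hc⟩⟩ ⟨S', ⟨⟨q', r'⟩, hc'⟩⟩ h
  have h1 : S = S' := Subtype.ext (by rw [← key ⟨S, ⟨⟨q, r⟩, hc⟩⟩, h, key])
  subst h1
  have h2 : q = q' := NzI.mul_cancel K (congrArg Prod.fst h)
  have h3 : r = r' := NzI.mul_cancel K (congrArg Prod.snd h)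
  subst h2 h3
  rfl

/-- Sum over coprime pairs. -/
noncomputable def copSum (a b : ℂ) : ℂ :=
  ∑' p : CopI K, nrm K p.1.1 (-a) * nrm K p.1.2 (-b)

lemma summable_cop (a b : ℂ) (ha : 1 < a.re) (hb : 1 < b.re) :
    Summable (fun p : CopI K ↦ ‖nrm K p.1.1 (-a) * nrm K p.1.2 (-b)‖) :=
  ((summable_norm_nrm K a ha).mul_norm (summable_norm_nrm K b hb)).subtype _

lemma zeta_mul_zeta (a b : ℂ) (ha : 1 < a.re) (hb : 1 < b.re) :
    zetaK K a * zetaK K b = zetaK K (a + b) * copSum K a b := by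
  have hab : 1 < (a + b).re := by rw [Complex.add_re]; linarith
  change (∑' I : NzI K, nrm K I (-a)) * (∑' I : NzI K, nrm K I (-b)) =
    (∑' I : NzI K, nrm K I (-(a + b))) * _
  rw [tsum_mul_tsum_of_summable_norm (summable_norm_nrm K a ha) (summable_norm_nrm K b hb), copSum,
    tsum_mul_tsum_of_summable_norm (summable_norm_nrm K _ hab) (summable_cop K a b ha hb)]
  rw [← (Equiv.ofBijective (mapA K) ⟨mapA_inj K, fun ⟨A, B⟩ ↦ exists_gcd K A B⟩).tsum_eq]
  refine tsum_congr fun t ↦ ?_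
  change nrm K (mapA K t).1 (-a) * nrm K (mapA K t).2 (-b) = _
  simp only [mapA, nrm_mul, neg_add, nrm_add]
  ring

lemma zeta_real_ne_zero (x : ℝ) (hx : 1 < x) : zetaK K (x : ℂ) ≠ 0 := by
  have hs := (summable_absNorm K x hx).subtype {I | I ≠ ⊥}
  have h : zetaK K (x : ℂ) = ((∑' I : NzI K, (Ideal.absNorm I.1 : ℝ) ^ (-x) : ℝ) : ℂ) := by
    rw [Complex.ofReal_tsum]
    refine tsum_congr fun I ↦ ?_
    rw [Complex.ofReal_cpow (by positivity)]
    simp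
  rw [h, Complex.ofReal_ne_zero]
  refine (hs.tsum_pos (fun I ↦ ?_) ⟨⊤, top_ne_bot⟩ ?_).ne'
  · simp only [Function.comp_apply]; positivity
  · simp

lemma zeta_ne_zero (w : ℂ) (hw : 2 < w.re) : zetaK K w ≠ 0 := by
  intro h0
  have hz : ∀ t : ℝ, 1 < t → t < w.re - 1 → zetaK K (w - t) = 0 := fun t h1 h2 ↦ by
    have := zeta_mul_zeta K (t : ℂ) (w - t) (by simpa using h1) (by simp; linarith)
    rw [add_sub_cancel, h0, zero_mul] at this
    exact (mul_eq_zero.1 this).resolve_left (zeta_real_ne_zero K t h1)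
  obtain ⟨x, hx1, hx2⟩ := exists_between (show (1 : ℝ) < w.re - 1 by linarith)
  obtain ⟨y, hy1, hy2⟩ := exists_between (show (1 : ℝ) < w.re - x by linarith)
  have hU : IsOpen {z : ℂ | y < z.re} := isOpen_lt continuous_const Complex.continuous_re
  have hd : DifferentiableOn ℂ (zetaK K) {z : ℂ | y < z.re} := by
    refine Complex.differentiableOn_tsum_of_summable_norm
      (F := fun (I : NzI K) z ↦ (Ideal.absNorm I.1 : ℂ) ^ (-z))
      ((summable_absNorm K y hy1).subtype {I | I ≠ ⊥}) (fun I ↦ ?_) hU (fun I z hz ↦ ?_)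
    · have : (Ideal.absNorm I.1 : ℂ) ≠ 0 := by exact_mod_cast (I.norm_pos K).ne'
      exact (DifferentiableOn.const_cpow (by fun_prop) (Or.inl this))
    · have := norm_nrm K I (-z)
      rw [nrm] at this
      rw [this]
      exact Real.rpow_le_rpow_of_exponent_le (by exact_mod_cast I.norm_pos K)
        (by simp; exact (show y < z.re from hz).le)
  have han := hd.analyticOnNhd hU
  have hconv : IsPreconnected {z : ℂ | y < z.re} :=
    (convex_halfSpace_re_gt y).isPreconnected
  have hfreq : ∃ᶠ z in 𝓝[≠] (w - x), zetaK K z = 0 := by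
    have ht : Tendsto (fun t : ℝ ↦ w - (t : ℂ)) (𝓝[≠] x) (𝓝[≠] (w - x)) := by
      refine tendsto_nhdsWithin_iff.2 ⟨?_, ?_⟩
      · exact (Continuous.tendsto (by fun_prop) x).mono_left nhdsWithin_le_nhds
      · filter_upwards [self_mem_nhdsWithin] with t ht
        simpa using ht
    refine ht.frequently (Eventually.frequently ?_)
    filter_upwards [nhdsWithin_le_nhds (Ioo_mem_nhds hx1 hx2)] with t ht using hz t ht.1 ht.2
  have hall := han.eqOn_zero_of_preconnected_of_frequently_eq_zero hconv
    (show y < (w - x).re by simpa using hy2) hfreq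
  exact zeta_real_ne_zero K (y + 1) (by linarith) (by
    simpa using hall (show y < ((y + 1 : ℝ) : ℂ).re by simp))

/-- Divisors of a nonzero ideal. -/
abbrev DivI (I : NzI K) : Type _ := {A : NzI K // A.1 ∣ I.1}

instance divI_finite (I : NzI K) : Finite (DivI K I) := by
  have h := (Ideal.finite_setOfPred_absNorm_le (S := 𝓞 K) (Ideal.absNorm I.1)).to_subtype
  refine Finite.of_injective (β := {J : Ideal (𝓞 K) | Ideal.absNorm J ≤ Ideal.absNorm I.1})
    (fun A ↦ ⟨A.1.1, Nat.le_of_dvd (I.norm_pos K) (map_dvd _ A.2)⟩) ?_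
  intro A B hAB
  exact Subtype.ext (Subtype.ext (Subtype.mk.inj hAB))

lemma sigmaK_eq (z : ℂ) (I : NzI K) : sigmaK K z I.1 = ∑' A : DivI K I, nrm K A.1 z := by
  have hinj : Function.Injective (fun A : DivI K I ↦ A.1.1) :=
    Subtype.val_injective.comp Subtype.val_injective
  rw [sigmaK, ← hinj.tsum_eq]
  · refine tsum_congr fun A ↦ ?_
    rw [if_pos A.2]; rfl
  · intro J hJ
    have hd : J ∣ I.1 := by
      by_contra h
      exact hJ (if_neg h)
    exact ⟨⟨⟨J, fun h ↦ I.2 (by rw [h] at hd; exact zero_dvd_iff.1 hd)⟩, hd⟩, rfl⟩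

/-- The parametrization of `(I, A, B)` with `A ∣ I`, `B ∣ I`. -/
noncomputable def mapB (t : NzI K × NzI K × CopI K) :
    (Σ I : NzI K, DivI K I × DivI K I) :=
  ⟨(t.2.1.mul t.2.2.1.1).mul (t.2.2.1.2.mul t.1),
    ⟨t.2.1.mul t.2.2.1.1, ⟨_, rfl⟩⟩,
    ⟨t.2.1.mul t.2.2.1.2, ⟨t.2.2.1.1.1 * t.1.1, by simp only [NzI.mul]; ring⟩⟩⟩

lemma mapB_bij : Function.Bijective (mapB K) := by
  constructor
  · rintro ⟨P, S, c⟩ ⟨P', S', c'⟩ h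
    have h1 : (S, c) = (S', c') := mapA_inj K (Prod.ext (congrArg (fun x ↦ x.2.1.1) h)
      (congrArg (fun x ↦ x.2.2.1) h))
    obtain ⟨rfl, rfl⟩ := Prod.mk.inj h1
    have h2 : P = P' := NzI.mul_cancel K (NzI.mul_cancel K (congrArg (fun x ↦ x.1) h))
    rw [h2]
  · rintro ⟨⟨I, hI⟩, ⟨A, hA⟩, ⟨B, hB⟩⟩
    obtain ⟨⟨S, ⟨⟨q, r⟩, hc⟩⟩, ht⟩ := exists_gcd K A B
    obtain ⟨rfl, rfl⟩ := Prod.mk.inj ht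
    simp only [NzI.mul] at hA hB
    obtain ⟨x, rfl⟩ := hA
    have h1 : r.1 ∣ q.1 * x := by
      rw [mul_assoc] at hB
      exact (mul_dvd_mul_iff_left S.2).1 hB
    have hcop : IsCoprime r.1 q.1 := (Ideal.isCoprime_iff_sup_eq.2 hc).symm
    obtain ⟨P, rfl⟩ := hcop.dvd_of_dvd_mul_left h1
    have hP : P ≠ ⊥ := fun h ↦ hI (by rw [h]; simp)
    exact ⟨(⟨P, hP⟩, S, ⟨(q, r), hc⟩), rfl⟩

lemma lhs_eq (z₁ z₂ s : ℂ) (h0 : 1 < s.re) (h1 : 1 < (s - z₁).re) (h2 : 1 < (s - z₂).re)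
    (h12 : 1 < (s - z₁ - z₂).re) :
    ∑' I : NzI K, sigmaK K z₁ I.1 * sigmaK K z₂ I.1 / (Ideal.absNorm I.1 : ℂ) ^ s =
      zetaK K s * (zetaK K (s - z₁ - z₂) * copSum K (s - z₁) (s - z₂)) := by
  let G : (Σ I : NzI K, DivI K I × DivI K I) → ℂ := fun x ↦
    nrm K x.2.1.1 z₁ * nrm K x.2.2.1 z₂ * nrm K x.1 (-s)
  have hterm : ∀ I : NzI K, sigmaK K z₁ I.1 * sigmaK K z₂ I.1 / (Ideal.absNorm I.1 : ℂ) ^ s =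
      ∑' p : DivI K I × DivI K I, G ⟨I, p⟩ := fun I ↦ by
    rw [sigmaK_eq, sigmaK_eq, tsum_mul_tsum_of_summable_norm Summable.of_finite Summable.of_finite,
      div_eq_mul_inv, ← tsum_mul_right]
    refine tsum_congr fun p ↦ ?_
    simp only [G, nrm_neg]
    rfl
  let F : NzI K × NzI K × CopI K → ℂ := fun t ↦ nrm K t.1 (-s) *
    (nrm K t.2.1 (-(s - z₁ - z₂)) * (nrm K t.2.2.1.1 (-(s - z₁)) * nrm K t.2.2.1.2 (-(s - z₂))))
  let e := Equiv.ofBijective (mapB K) (mapB_bij K)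
  have hGF : ∀ t, G (e t) = F t := fun t ↦ by
    simp only [G, F, e, Equiv.ofBijective_apply, mapB, nrm_mul]
    rw [show -(s - z₁ - z₂) = z₁ + z₂ + -s by ring, show -(s - z₁) = z₁ + -s by ring,
      show -(s - z₂) = z₂ + -s by ring]
    simp only [nrm_add]
    ring
  have hc := summable_cop K _ _ h1 h2
  have hsc := (summable_norm_nrm K _ h12).mul_norm hc
  have hF : Summable F := ((summable_norm_nrm K _ h0).mul_norm hsc).of_norm
  have hG : Summable G := by
    rw [← e.summable_iff]
    exact hF.congr fun t ↦ (hGF t).symm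
  rw [tsum_congr hterm, ← hG.tsum_sigma, ← e.tsum_eq, tsum_congr hGF]
  change _ = (∑' I : NzI K, nrm K I (-s)) * ((∑' I : NzI K, nrm K I (-(s - z₁ - z₂))) * _)
  rw [copSum, tsum_mul_tsum_of_summable_norm (summable_norm_nrm K _ h12) hc,
    tsum_mul_tsum_of_summable_norm (summable_norm_nrm K _ h0) hsc]

end helpers

/-- Ramanujan's identity over a number field `K`. -/
theorem sigmaK_ramanujan_identity (z₁ z₂ s : ℂ)
    (hs : max (max 1 (1 + z₁.re)) (max (1 + z₂.re) (1 + (z₁ + z₂).re)) < s.re) :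
    ∑' I : {I : Ideal (𝓞 K) // I ≠ ⊥},
        sigmaK K z₁ I.1 * sigmaK K z₂ I.1 / (Ideal.absNorm I.1 : ℂ) ^ s =
      zetaK K s * zetaK K (s - z₁) * zetaK K (s - z₂) * zetaK K (s - z₁ - z₂) /
        zetaK K (2 * s - z₁ - z₂) := by
  obtain ⟨ha, hb⟩ := max_lt_iff.1 hs
  obtain ⟨h0, h1⟩ := max_lt_iff.1 ha
  obtain ⟨h2, h12⟩ := max_lt_iff.1 hb
  simp only [Complex.add_re] at h12
  have h1' : 1 < (s - z₁).re := by rw [Complex.sub_re]; linarith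
  have h2' : 1 < (s - z₂).re := by rw [Complex.sub_re]; linarith
  have h12' : 1 < (s - z₁ - z₂).re := by simp only [Complex.sub_re]; linarith
  have hz := zeta_mul_zeta K _ _ h1' h2'
  have hne := zeta_ne_zero K (2 * s - z₁ - z₂) (by
    simp only [Complex.sub_re, Complex.mul_re, Complex.re_ofNat, Complex.im_ofNat]; linarith)
  rw [show s - z₁ + (s - z₂) = 2 * s - z₁ - z₂ by ring] at hz
  rw [eq_div_iff hne]
  refine (congrArg (· * zetaK K (2 * s - z₁ - z₂)) (lhs_eq K z₁ z₂ s h0 h1' h2' h12')).trans ?_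
  linear_combination (-(zetaK K s * zetaK K (s - z₁ - z₂))) * hz
end
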